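/- Let F be a free group, let C be a normal subgroup of F of finite index, and let L be a nontrivial normal subgroup of C. Then there exists a nontrivial normal subgroup N of F with N ≤ L. (Concretely, the intersection of the finitely many F-conjugates of L is a nontrivial normal subgroup of F contained in L.) -/

import Mathlib

namespace IsFreeGroup

theorem isMulTorsionFree (G : Type*) [Group G] [IsFreeGroup G] : IsMulTorsionFree G :=
  (toFreeGroup G).injective.isMulTorsionFree (toFreeGroup G).toMonoidHom

theorem subsingleton_generators_of_comm {G : Type*} [Group G] [IsFreeGroup G]
    (h : ∀ a b : G, a * b = b * a) : Subsingleton (Generators G) := by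
  classical
  refine ⟨fun x y => by_contra fun hxy => ?_⟩
  let f : Generators G → Equiv.Perm (Fin 3) :=
    fun z => if z = x then Equiv.swap 0 1 else Equiv.swap 1 2
  have hf := congrArg (lift f) (h (of x) (of y))
  simp only [map_mul, lift_of, f, if_pos, if_neg (Ne.symm hxy)] at hf
  revert hf
  decide

theorem isCyclic_of_comm {G : Type*} [Group G] [IsFreeGroup G]
    (h : ∀ a b : G, a * b = b * a) : IsCyclic G := by
  have := subsingleton_generators_of_comm h
  cases isEmpty_or_nonempty (Generators G) with
  | inl he =>
    have := (toFreeGroup G).toEquiv.subsingleton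
    infer_instance
  | inr hn =>
    obtain ⟨x⟩ := hn
    refine ⟨of x, fun g => ?_⟩
    have hG : (zpowersHom G (of x)).comp
        (lift fun _ => Multiplicative.ofAdd (1 : ℤ)) = MonoidHom.id G :=
      ext_hom fun y => by simp [Subsingleton.elim y x]
    exact ⟨Multiplicative.toAdd (lift (fun _ => Multiplicative.ofAdd (1 : ℤ)) g),
      DFunLike.congr_fun hG g⟩

theorem exists_zpow_eq_zpow_of_commute {G : Type*} [Group G] [IsFreeGroup G] {a b : G}
    (hab : Commute a b) (ha : a ≠ 1) (hb : b ≠ 1) :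
    ∃ m n : ℤ, a ^ m = b ^ n ∧ a ^ m ≠ 1 := by
  have := isMulTorsionFree G
  let H := Subgroup.closure ({a, b} : Set G)
  have hH : IsMulCommutative H := Subgroup.isMulCommutative_closure (by
    rintro x (rfl | rfl) y (rfl | rfl)
    exacts [rfl, hab, hab.symm, rfl])
  have : IsCyclic H := isCyclic_of_comm fun x y => hH.is_comm.comm x y
  obtain ⟨g, hg⟩ := IsCyclic.exists_generator (α := H)
  obtain ⟨m, hm⟩ := hg ⟨a, Subgroup.subset_closure (by simp)⟩
  obtain ⟨n, hn⟩ := hg ⟨b, Subgroup.subset_closure (by simp)⟩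
  replace hm : (g : G) ^ m = a := by simpa using congrArg Subtype.val hm
  replace hn : (g : G) ^ n = b := by simpa using congrArg Subtype.val hn
  have hn0 : n ≠ 0 := by
    rintro rfl
    exact hb (by simpa using hn.symm)
  refine ⟨n, m, ?_, fun h => ha ?_⟩
  · rw [← hm, ← hn, ← zpow_mul, ← zpow_mul, mul_comm]
  · exact (IsMulTorsionFree.zpow_eq_one_iff_left hn0).1 h

theorem inf_ne_bot {G : Type*} [Group G] [IsFreeGroup G] {A B : Subgroup G}
    (hA : A.Normal) (hB : B.Normal) (hA' : A ≠ ⊥) (hB' : B ≠ ⊥) : A ⊓ B ≠ ⊥ := by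
  intro h
  obtain ⟨a, ha, ha1⟩ := A.bot_or_exists_ne_one.resolve_left hA'
  obtain ⟨b, hb, hb1⟩ := B.bot_or_exists_ne_one.resolve_left hB'
  have hab := Subgroup.commute_of_normal_of_disjoint A B hA hB (disjoint_iff.2 h) a b ha hb
  obtain ⟨m, n, hmn, hne⟩ := exists_zpow_eq_zpow_of_commute hab ha1 hb1
  have hmem : a ^ m ∈ A ⊓ B := ⟨A.zpow_mem ha m, hmn ▸ B.zpow_mem hb n⟩
  rw [h] at hmem
  exact hne (Subgroup.mem_bot.1 hmem)

theorem sInf_ne_bot {G : Type*} [Group G] [IsFreeGroup G] [Nontrivial G]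
    {S : Set (Subgroup G)} (hS : S.Finite) (hn : ∀ A ∈ S, A.Normal) (hb : ∀ A ∈ S, A ≠ ⊥) :
    sInf S ≠ ⊥ := by
  induction S, hS using Set.Finite.induction_on with
  | empty => simp
  | @insert A S _ _ ih =>
    rw [sInf_insert]
    refine inf_ne_bot (hn A (by simp)) ?_ (hb A (by simp)) ?_
    · rw [sInf_eq_iInf']
      exact Subgroup.normal_iInf_normal fun B => hn B (Set.mem_insert_of_mem _ B.2)
    · exact ih (fun B hB => hn B (Set.mem_insert_of_mem _ hB))
        (fun B hB => hb B (Set.mem_insert_of_mem _ hB))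

end IsFreeGroup

theorem Subgroup.finite_range_comap_conjNormal {G : Type*} [Group G] (C : Subgroup G)
    [C.Normal] [C.FiniteIndex] (K : Subgroup C) [K.Normal] :
    (Set.range fun g : G => K.comap (MulAut.conjNormal g⁻¹ : MulAut C).toMonoidHom).Finite := by
  refine (Set.finite_range fun q : G ⧸ C =>
    K.comap (MulAut.conjNormal q.out⁻¹ : MulAut C).toMonoidHom).subset ?_
  rintro _ ⟨g, rfl⟩
  refine ⟨(g : G ⧸ C), ?_⟩
  obtain ⟨c, hc⟩ := QuotientGroup.mk_out_eq_mul C g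
  ext x
  have hx : (MulAut.conjNormal (g * c : G)⁻¹ : MulAut C) x =
      c⁻¹ * (MulAut.conjNormal g⁻¹ : MulAut C) x * c⁻¹⁻¹ := by
    ext
    simp [mul_assoc]
  simp only [hc, Subgroup.mem_comap, MulEquiv.toMonoidHom_eq_coe, MonoidHom.coe_coe, hx]
  exact (‹K.Normal›.mem_comm_iff.trans (by simp))


/-- If `C` is a finite-index normal subgroup of a free group `F` and `L` is a
nontrivial normal subgroup of `C`, then `L` contains a nontrivial normal
subgroup of `F`. -/
theorem stmt_6 {F : Type*} [Group F] [IsFreeGroup F]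
    (C : Subgroup F) (hCn : C.Normal) (hCi : C.FiniteIndex)
    (L : Subgroup F) (hLC : L ≤ C) (hLn : (L.subgroupOf C).Normal) (hL : L ≠ ⊥) :
    ∃ N : Subgroup F, N.Normal ∧ N ≠ ⊥ ∧ N ≤ L := by
  have : Nontrivial C := by
    obtain ⟨x, hx, hx1⟩ := L.bot_or_exists_ne_one.resolve_left hL
    exact ⟨⟨x, hLC hx⟩, 1, fun h => hx1 (congrArg Subtype.val h)⟩
  have hS := IsFreeGroup.sInf_ne_bot (C.finite_range_comap_conjNormal (L.subgroupOf C))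
    (by
      rintro _ ⟨g, rfl⟩
      exact hLn.comap _)
    (by
      rintro _ ⟨g, rfl⟩ h
      obtain ⟨x, hx, hx1⟩ := L.bot_or_exists_ne_one.resolve_left hL
      have hmem : (MulAut.conjNormal g : MulAut C) ⟨x, hLC hx⟩ ∈
          (L.subgroupOf C).comap (MulAut.conjNormal g⁻¹ : MulAut C).toMonoidHom := by
        simpa [Subgroup.mem_subgroupOf, mul_assoc] using hx
      have h_one := (map_eq_one_iff _ (MulEquiv.injective _)).1 (Subgroup.mem_bot.1 (h.le hmem))
      exact hx1 (congrArg Subtype.val h_one))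
  refine ⟨L.normalCore, L.normalCore_normal, fun h => ?_, L.normalCore_le⟩
  obtain ⟨x, hx, hx1⟩ := (Subgroup.bot_or_exists_ne_one _).resolve_left hS
  have hmem : (x : F) ∈ L.normalCore := fun g => by
    simpa [Subgroup.mem_subgroupOf] using Subgroup.mem_sInf.1 hx _ ⟨g⁻¹, rfl⟩
  rw [h, Subgroup.mem_bot] at hmem
  exact hx1 (Subtype.ext hmem)
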